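/- Fix an integer n ≥ 2. There exist constants C(n) > 0 and ξ_0(n) > 0 such that for all 0 < ξ < ξ_0(n), |∫_{−∞}^{+∞} (ω_n(ξ,t) − φ_{n−1}(t)) dt − 2^n| ≤ C(n)·ξ^{1/2}. -/

import Mathlib

open MeasureTheory Filter

/-- The domain `D_n(ξ,t) ⊆ ℝ^{n-1}`. -/
def Dset (n : ℕ) (ξ t : ℝ) : Set (Fin (n - 1) → ℝ) :=
  {p | (∀ i, |p i| ≤ 1) ∧ |ξ * t ^ n + ∑ i, p i * t ^ ((i : ℕ) + 1)| ≤ 1}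

/-- The density function `ω_n(ξ,t)`. -/
noncomputable def omegaFn (n : ℕ) (ξ t : ℝ) : ℝ :=
  ∫ p in Dset n ξ t,
    |(n : ℝ) * ξ * t ^ (n - 1) + ∑ i : Fin (n - 1), ((i : ℕ) + 1 : ℝ) * p i * t ^ (i : ℕ)|

/-- The domain `G_n(t) ⊆ ℝ^n`: vectors `(p_1, …, p_n)` (indexed by `i : Fin n`, where `p i`
stands for `p_{i+1}`) with `|p_i| ≤ 1` and `|∑_{k=1}^{n} p_k t^k| ≤ 1`. -/
def Gset (n : ℕ) (t : ℝ) : Set (Fin n → ℝ) :=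
  {p | (∀ i, |p i| ≤ 1) ∧ |∑ i, p i * t ^ ((i : ℕ) + 1)| ≤ 1}

/-- The density function `φ_n(t)` of real algebraic numbers of degree `n`. -/
noncomputable def phiFn (n : ℕ) (t : ℝ) : ℝ :=
  ∫ p in Gset n t, |∑ i : Fin n, ((i : ℕ) + 1 : ℝ) * p i * t ^ (i : ℕ)|


def Zset (d : ℕ) (ξ t A : ℝ) : Set ℝ :=
  {x | |x| ≤ 1 ∧ |ξ * t ^ (d + 2) + (A + x * t ^ (d + 1))| ≤ 1}

noncomputable def innI (d : ℕ) (ξ t A B : ℝ) : ℝ → ℝ :=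
  (Zset d ξ t A).indicator
    (fun x => |((d : ℝ) + 2) * ξ * t ^ (d + 1) + (B + ((d : ℝ) + 1) * x * t ^ d)|)

noncomputable def Af (d : ℕ) (t : ℝ) (q : Fin d → ℝ) : ℝ := ∑ i, q i * t ^ ((i : ℕ) + 1)
noncomputable def Bf (d : ℕ) (t : ℝ) (q : Fin d → ℝ) : ℝ :=
  ∑ i : Fin d, ((i : ℕ) + 1 : ℝ) * q i * t ^ (i : ℕ)

def cubeS (d : ℕ) : Set (Fin d → ℝ) := {q | ∀ i, |q i| ≤ 1}

lemma cubeS_eq (d : ℕ) : cubeS d = Set.Icc (fun _ => (-1 : ℝ)) (fun _ => 1) := by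
  ext q
  simp only [cubeS, Set.mem_ofPred_eq, Set.mem_Icc, Pi.le_def, abs_le]
  exact forall_and

lemma cubeS_meas (d : ℕ) : MeasurableSet (cubeS d) := by
  rw [cubeS_eq]; exact measurableSet_Icc

lemma cubeS_vol (d : ℕ) : volume.real (cubeS d) = 2 ^ d := by
  rw [cubeS_eq, Measure.real, Real.volume_Icc_pi_toReal]
  · simp; norm_num
  · intro i; norm_num

lemma isClosed_D (n : ℕ) (ξ : ℝ) :
    IsClosed {z : ℝ × (Fin (n - 1) → ℝ) | z.2 ∈ Dset n ξ z.1} := by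
  have h : {z : ℝ × (Fin (n - 1) → ℝ) | z.2 ∈ Dset n ξ z.1} =
      (⋂ i, {z : ℝ × (Fin (n - 1) → ℝ) | |z.2 i| ≤ 1}) ∩ {z : ℝ × (Fin (n - 1) → ℝ) |
        |ξ * z.1 ^ n + ∑ i, z.2 i * z.1 ^ ((i : ℕ) + 1)| ≤ 1} := by
    ext z; simp [Dset]
  rw [h]
  refine IsClosed.inter (isClosed_iInter fun i => ?_) ?_
  · exact isClosed_le (by fun_prop) (by fun_prop)
  · exact isClosed_le (by fun_prop) (by fun_prop)

lemma isCompact_D (n : ℕ) (ξ t : ℝ) : IsCompact (Dset n ξ t) := by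
  have h1 : IsClosed (Dset n ξ t) := by
    have := (isClosed_D n ξ).preimage (f := fun p : Fin (n - 1) → ℝ => (t, p)) (by fun_prop)
    exact this
  have h2 : IsCompact (cubeS (n - 1)) := by
    rw [cubeS_eq]; exact isCompact_Icc
  exact h2.of_isClosed_subset h1 (fun p hp => hp.1)

lemma omega_meas (n : ℕ) (ξ : ℝ) : StronglyMeasurable (fun t => omegaFn n ξ t) := by
  have : (fun t => omegaFn n ξ t) = fun t => ∫ p : Fin (n - 1) → ℝ,
      ({z : ℝ × (Fin (n - 1) → ℝ) | z.2 ∈ Dset n ξ z.1}.indicator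
        (fun z => |(n : ℝ) * ξ * z.1 ^ (n - 1)
          + ∑ i : Fin (n - 1), ((i : ℕ) + 1 : ℝ) * z.2 i * z.1 ^ (i : ℕ)|)) (t, p) := by
    funext t
    rw [omegaFn, ← integral_indicator (isCompact_D n ξ t).measurableSet]
    rfl
  rw [this]
  apply StronglyMeasurable.integral_prod_right'
  refine StronglyMeasurable.indicator ?_ (isClosed_D n ξ).measurableSet
  exact Continuous.stronglyMeasurable (by fun_prop)

lemma phi_eq (d : ℕ) (t : ℝ) : phiFn (d + 1) t = omegaFn (d + 2) 0 t := by
  simp [phiFn, omegaFn, Gset, Dset]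

lemma isCompact_Z (d : ℕ) (ξ t A : ℝ) : IsCompact (Zset d ξ t A) := by
  have h : Zset d ξ t A = {x : ℝ | |x| ≤ 1} ∩
      {x : ℝ | |ξ * t ^ (d + 2) + (A + x * t ^ (d + 1))| ≤ 1} := by
    ext x; simp [Zset]
  have h1 : IsClosed (Zset d ξ t A) := by
    rw [h]
    exact IsClosed.inter (isClosed_le (by fun_prop) (by fun_prop))
      (isClosed_le (by fun_prop) (by fun_prop))
  refine (isCompact_Icc (a := (-1 : ℝ)) (b := 1)).of_isClosed_subset h1 ?_
  intro x hx
  exact abs_le.1 hx.1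

lemma innI_int (d : ℕ) (ξ t A B : ℝ) : Integrable (innI d ξ t A B) := by
  rw [innI, integrable_indicator_iff (isCompact_Z d ξ t A).measurableSet]
  exact ContinuousOn.integrableOn_compact (isCompact_Z d ξ t A) (by fun_prop)

lemma omega_fubini (d : ℕ) (ξ t : ℝ) :
    IntegrableOn (fun q => ∫ x, innI d ξ t (Af d t q) (Bf d t q) x) (cubeS d) ∧
    omegaFn (d + 2) ξ t = ∫ q in cubeS d, ∫ x, innI d ξ t (Af d t q) (Bf d t q) x := by
  obtain ⟨D, hD⟩ : ∃ D : Set (Fin (d + 1) → ℝ), D = Dset (d + 2) ξ t := ⟨_, rfl⟩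
  have hDm : MeasurableSet D := by rw [hD]; exact (isCompact_D (d + 2) ξ t).measurableSet
  have hDc : IsCompact D := by rw [hD]; exact isCompact_D (d + 2) ξ t
  set F : (Fin (d + 1) → ℝ) → ℝ := D.indicator (fun p =>
    |((d + 2 : ℕ) : ℝ) * ξ * t ^ (d + 1)
      + ∑ i : Fin (d + 1), ((i : ℕ) + 1 : ℝ) * p i * t ^ (i : ℕ)|) with hF
  have hFi : Integrable F := by
    rw [hF, integrable_indicator_iff hDm]
    exact ContinuousOn.integrableOn_compact hDc (by fun_prop)
  have hmp := (volume_preserving_piFinSuccAbove (fun _ : Fin (d + 1) => ℝ) (Fin.last d)).symm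
  set e := (MeasurableEquiv.piFinSuccAbove (fun _ : Fin (d + 1) => ℝ) (Fin.last d)).symm with he
  have hi2 : Integrable (fun z => F (e z)) := (hmp.integrable_comp_emb e.measurableEmbedding).2 hFi
  have hpt : ∀ x : ℝ, ∀ q : Fin d → ℝ, F (e (x, q)) =
      (cubeS d).indicator (fun q => innI d ξ t (Af d t q) (Bf d t q) x) q := by
    intro x q
    have e1 : ∀ i : Fin d, e (x, q) i.castSucc = q i := by
      intro i
      simp [he, MeasurableEquiv.piFinSuccAbove, Fin.insertNthEquiv, Fin.insertNth_last']
    have e2 : e (x, q) (Fin.last d) = x := by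
      simp [he, MeasurableEquiv.piFinSuccAbove, Fin.insertNthEquiv, Fin.insertNth_last']
    have hmem : e (x, q) ∈ D ↔ q ∈ cubeS d ∧ x ∈ Zset d ξ t (Af d t q) := by
      rw [hD]
      change ((∀ i : Fin (d + 1), _) ∧ |_ + ∑ i : Fin (d + 1), _| ≤ 1) ↔ _
      rw [Fin.forall_fin_succ', Fin.sum_univ_castSucc]
      simp only [e1, e2, cubeS, Zset, Af, Set.mem_ofPred_eq, Fin.val_castSucc, Fin.val_last]
      tauto
    classical
    rw [hF, Set.indicator_apply, Set.indicator_apply, innI, Set.indicator_apply]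
    simp only [hmem, Fin.sum_univ_castSucc, e1, e2, Bf,
      Fin.val_castSucc, Fin.val_last]
    by_cases h1 : q ∈ cubeS d <;> by_cases h2 : x ∈ Zset d ξ t (Af d t q) <;> simp [h1, h2]
  have hsw : ∀ q, ∫ x, F (e (x, q)) =
      (cubeS d).indicator (fun q => ∫ x, innI d ξ t (Af d t q) (Bf d t q) x) q := by
    intro q
    simp only [hpt]
    by_cases h1 : q ∈ cubeS d <;> simp [h1]
  constructor
  · rw [← integrable_indicator_iff (cubeS_meas d)]
    have := hi2.integral_prod_right
    refine this.congr (Eventually.of_forall fun q => ?_)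
    exact hsw q
  · have h0 : omegaFn (d + 2) ξ t = ∫ p, F p := by
      rw [hF, integral_indicator hDm, hD]
      rfl
    rw [h0, ← hmp.integral_comp e.measurableEmbedding, ← integral_indicator (cubeS_meas d)]
    change ∫ z, F (e z) ∂(volume.prod volume) = _
    rw [integral_prod_symm _ hi2]
    simp only [hsw]

lemma Af_bd (d : ℕ) (t : ℝ) (ht : 1 ≤ |t|) (q) (hq : q ∈ cubeS d) : |Af d t q| ≤ d * |t| ^ d := by
  refine (Finset.abs_sum_le_sum_abs _ _).trans ?_
  refine (Finset.sum_le_card_nsmul _ _ (|t| ^ d) fun i _ => ?_).trans (by simp)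
  rw [abs_mul, abs_pow]
  calc |q i| * |t| ^ ((i : ℕ) + 1) ≤ 1 * |t| ^ d := by
        gcongr
        · exact hq i
        · omega
    _ = _ := one_mul _

lemma Bf_bd (d : ℕ) (t : ℝ) (ht : 1 ≤ |t|) (q) (hq : q ∈ cubeS d) :
    |Bf d t q| * |t| ≤ d * (d * |t| ^ d) := by
  rw [← abs_mul, Bf, Finset.sum_mul]
  refine (Finset.abs_sum_le_sum_abs _ _).trans ?_
  refine (Finset.sum_le_card_nsmul _ _ (d * |t| ^ d) fun i _ => ?_).trans (by simp)
  have hi : ((i : ℕ) : ℝ) + 1 ≤ d := by exact_mod_cast i.2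
  rw [mul_assoc, ← pow_succ, abs_mul, abs_mul, abs_pow, abs_of_nonneg (by positivity : (0:ℝ) ≤ (i:ℕ) + 1)]
  calc (((i : ℕ) : ℝ) + 1) * |q i| * |t| ^ ((i : ℕ) + 1) ≤ d * 1 * |t| ^ d := by
        gcongr
        · exact hq i
        · omega
    _ = _ := by ring

lemma Bf_bd2 (d : ℕ) (t M : ℝ) (hM : 1 ≤ M) (ht : |t| ≤ M) (q) (hq : q ∈ cubeS d) :
    |Bf d t q| ≤ d * (d * M ^ d) := by
  refine (Finset.abs_sum_le_sum_abs _ _).trans ?_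
  refine (Finset.sum_le_card_nsmul _ _ (d * M ^ d) fun i _ => ?_).trans (by simp)
  have hi : ((i : ℕ) : ℝ) + 1 ≤ d := by exact_mod_cast i.2
  rw [abs_mul, abs_mul, abs_pow, abs_of_nonneg (by positivity : (0:ℝ) ≤ (i:ℕ) + 1)]
  calc (((i : ℕ) : ℝ) + 1) * |q i| * |t| ^ ((i : ℕ)) ≤ d * 1 * M ^ d := by
        gcongr ?_ * ?_ * ?_
        · exact hq i
        · calc |t| ^ (i : ℕ) ≤ M ^ (i : ℕ) := by gcongr
            _ ≤ M ^ d := by gcongr; omega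
    _ = _ := by ring

/-- shifted integrand -/
lemma shift_eq (d : ℕ) (ξ t A B : ℝ) (x : ℝ) :
    innI d ξ t A B (x - ξ * t) = {x : ℝ | |x - ξ * t| ≤ 1 ∧ |A + x * t ^ (d + 1)| ≤ 1}.indicator
      (fun x => |ξ * t ^ (d + 1) + (B + ((d : ℝ) + 1) * x * t ^ d)|) x := by
  have h1 : ξ * t ^ (d + 2) + (A + (x - ξ * t) * t ^ (d + 1)) = A + x * t ^ (d + 1) := by ring
  have h2 : ((d : ℝ) + 2) * ξ * t ^ (d + 1) + (B + ((d : ℝ) + 1) * (x - ξ * t) * t ^ d)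
    = ξ * t ^ (d + 1) + (B + ((d : ℝ) + 1) * x * t ^ d) := by ring
  simp only [innI, Set.indicator_apply, Zset, Set.mem_ofPred_eq, h1, h2]

lemma zero_eq (d : ℕ) (t A B : ℝ) (x : ℝ) :
    innI d 0 t A B x = {x : ℝ | |x| ≤ 1 ∧ |A + x * t ^ (d + 1)| ≤ 1}.indicator
      (fun x => |B + ((d : ℝ) + 1) * x * t ^ d|) x := by
  simpa using shift_eq d 0 t A B x

lemma diff_int (d : ℕ) (ξ t A B : ℝ) :
    (∫ x, innI d ξ t A B x) - (∫ x, innI d 0 t A B x) =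
      ∫ x, (innI d ξ t A B (x - ξ * t) - innI d 0 t A B x) := by
  rw [integral_sub _ (innI_int _ _ _ _ _), integral_sub_right_eq_self (innI d ξ t A B)]
  exact (innI_int d ξ t A B).comp_sub_right (ξ * t)

lemma small_t (d : ℕ) (ξ t A B M b : ℝ) (hM : 1 ≤ M) (ht : |t| ≤ M) (hb : |B| ≤ b)
    (h0 : 0 < ξ) (hξ : ξ * M ≤ 1) :
    |(∫ x, innI d ξ t A B x) - (∫ x, innI d 0 t A B x)| ≤
      (2 * M ^ (d + 1) + 4 * M * (M ^ (d + 1) + b + 2 * (d + 1) * M ^ d)) * ξ := by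
  rw [diff_int]
  set K := M ^ (d + 1) + b + 2 * (d + 1) * M ^ d with hK
  set g : ℝ → ℝ := fun x => (Set.Icc (-1 : ℝ) 1).indicator (fun _ => ξ * M ^ (d + 1)) x
    + ((Set.Icc (-1 - ξ * M) (-1 + ξ * M)).indicator (fun _ => K) x
      + (Set.Icc (1 - ξ * M) (1 + ξ * M)).indicator (fun _ => K) x) with hg
  have ii : ∀ a b c : ℝ, Integrable ((Set.Icc a b).indicator (fun _ => c)) := by
    intro a b c
    rw [integrable_indicator_iff measurableSet_Icc]
    exact integrableOn_const (by simp)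
  have hgi : Integrable g := (ii _ _ _).add ((ii _ _ _).add (ii _ _ _))
  have hb0 : 0 ≤ b := (abs_nonneg _).trans hb
  have hM0 : 0 ≤ M := by linarith
  have hξM : 0 ≤ ξ * M := by positivity
  have hξ1 : ξ ≤ 1 := by nlinarith
  have hK0 : 0 ≤ K := by positivity
  have hst : |ξ * t| ≤ ξ * M := by rw [abs_mul, abs_of_pos h0]; gcongr
  have key : ∀ x, ‖innI d ξ t A B (x - ξ * t) - innI d 0 t A B x‖ ≤ g x := by
    intro x
    rw [shift_eq, zero_eq, Real.norm_eq_abs]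
    have hn1 : 0 ≤ (Set.Icc (-1 : ℝ) 1).indicator (fun _ => ξ * M ^ (d + 1)) x :=
      Set.indicator_nonneg (fun _ _ => by positivity) _
    have hn2 : 0 ≤ (Set.Icc (-1 - ξ * M) (-1 + ξ * M)).indicator (fun _ => K) x :=
      Set.indicator_nonneg (fun _ _ => hK0) _
    have hn3 : 0 ≤ (Set.Icc (1 - ξ * M) (1 + ξ * M)).indicator (fun _ => K) x :=
      Set.indicator_nonneg (fun _ _ => hK0) _
    have hst' := abs_le.1 hst
    have hp1 : |ξ * t ^ (d + 1)| ≤ ξ * M ^ (d + 1) := by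
      rw [abs_mul, abs_of_pos h0, abs_pow]; gcongr
    have hp2 : |x| ≤ 2 → |B + ((d : ℝ) + 1) * x * t ^ d| ≤ b + 2 * (d + 1) * M ^ d := by
      intro hx
      refine (abs_add_le _ _).trans (add_le_add hb ?_)
      rw [abs_mul, abs_mul, abs_pow, abs_of_nonneg (by positivity : (0:ℝ) ≤ d + 1)]
      calc ((d : ℝ) + 1) * |x| * |t| ^ d ≤ (d + 1) * 2 * M ^ d := by gcongr
        _ = _ := by ring
    have hp3 : ξ * M ^ (d + 1) ≤ M ^ (d + 1) := by
      have : 0 ≤ M ^ (d + 1) := by positivity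
      nlinarith
    have hedge : ∀ v, |v| ≤ K → ((-1 - ξ * M ≤ x ∧ x ≤ -1 + ξ * M) ∨ (1 - ξ * M ≤ x ∧ x ≤ 1 + ξ * M))
        → |v| ≤ g x := by
      rintro v hv (h | h)
      · have : (Set.Icc (-1 - ξ * M) (-1 + ξ * M)).indicator (fun _ => K) x = K :=
          Set.indicator_of_mem (Set.mem_Icc.2 h) _
        simp only [hg]; linarith
      · have : (Set.Icc (1 - ξ * M) (1 + ξ * M)).indicator (fun _ => K) x = K :=
          Set.indicator_of_mem (Set.mem_Icc.2 h) _
        simp only [hg]; linarith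
    simp only [Set.indicator_apply (s := {x | _}), Set.mem_ofPred_eq]
    by_cases hA : |A + x * t ^ (d + 1)| ≤ 1
    swap
    · simp only [hA, and_false, if_false, sub_zero, abs_zero]
      simp only [hg]; linarith
    simp only [hA, and_true]
    by_cases h1 : |x - ξ * t| ≤ 1 <;> by_cases h2 : |x| ≤ 1
    · simp only [h1, h2, if_true]
      refine (abs_abs_sub_abs_le _ _).trans ?_
      have : (Set.Icc (-1 : ℝ) 1).indicator (fun _ => ξ * M ^ (d + 1)) x = ξ * M ^ (d + 1) :=
          Set.indicator_of_mem (Set.mem_Icc.2 (abs_le.1 h2)) _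
      rw [add_sub_cancel_right]
      simp only [hg]; linarith
    · simp only [h1, h2, if_true, if_false, sub_zero]
      have h1' := abs_le.1 h1
      apply hedge
      · rw [abs_abs]
        have := hp2 (abs_le.2 ⟨by linarith, by linarith⟩)
        have := abs_add_le (ξ * t ^ (d + 1)) (B + ((d : ℝ) + 1) * x * t ^ d)
        linarith
      · rw [abs_le, not_and_or] at h2
        rcases h2 with h2 | h2
        · left; constructor <;> linarith
        · right; constructor <;> linarith
    · simp only [h1, h2, if_true, if_false, zero_sub]
      have h2' := abs_le.1 h2
      apply hedge
      · rw [abs_neg, abs_abs]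
        have := hp2 (h2.trans (by norm_num))
        have : 0 ≤ M ^ (d + 1) := by positivity
        linarith
      · rw [abs_le, not_and_or] at h1
        rcases h1 with h1 | h1
        · left; constructor <;> linarith
        · right; constructor <;> linarith
    · simp only [h1, h2, if_false, sub_zero, abs_zero]
      simp only [hg]; linarith
  have := norm_integral_le_of_norm_le hgi (Eventually.of_forall key)
  rw [Real.norm_eq_abs] at this
  refine this.trans (le_of_eq ?_)
  have iv : ∀ a b c : ℝ, a ≤ b → ∫ x, (Set.Icc a b).indicator (fun _ => c) x = (b - a) * c := by
    intro a b c h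
    rw [integral_indicator measurableSet_Icc, setIntegral_const]
    simp [h]
  simp only [hg]
  have hi2 : Integrable (fun x => (Set.Icc (-1 - ξ * M) (-1 + ξ * M)).indicator (fun _ => K) x
      + (Set.Icc (1 - ξ * M) (1 + ξ * M)).indicator (fun _ => K) x) := (ii _ _ _).add (ii _ _ _)
  rw [integral_add (ii _ _ _) hi2, integral_add (ii _ _ _) (ii _ _ _),
    iv _ _ _ (by norm_num), iv _ _ _ (by linarith), iv _ _ _ (by linarith)]
  ring

lemma big_t (d : ℕ) (ξ t A B E χ : ℝ) (ht : 1 ≤ |t|)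
    (hp : ∀ x, |A + x * t ^ (d + 1)| ≤ 1 →
      |(if |x - ξ * t| ≤ 1 then |ξ * t ^ (d + 1) + (B + ((d : ℝ) + 1) * x * t ^ d)| else 0)
        - (if |x| ≤ 1 then |B + ((d : ℝ) + 1) * x * t ^ d| else 0)
        - |t| ^ (d + 1) * (ξ * χ)| ≤ |t| ^ (d + 1) * E) :
    |(∫ x, innI d ξ t A B x) - (∫ x, innI d 0 t A B x) - 2 * ξ * χ| ≤ 2 * E := by
  have ht0 : t ≠ 0 := by intro h; rw [h, abs_zero] at ht; linarith
  set P := |t| ^ (d + 1) with hP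
  have hP0 : 0 < P := by positivity
  set S : Set ℝ := Metric.closedBall (-A / t ^ (d + 1)) (1 / P) with hS
  have hmem : ∀ x, x ∈ S ↔ |A + x * t ^ (d + 1)| ≤ 1 := by
    intro x
    rw [hS, Metric.mem_closedBall, Real.dist_eq, le_div_iff₀ hP0, hP, ← abs_pow, ← abs_mul]
    have : (x - -A / t ^ (d + 1)) * t ^ (d + 1) = A + x * t ^ (d + 1) := by
      field_simp; ring
    rw [this]
  have hSm : MeasurableSet S := Metric.isClosed_closedBall.measurableSet
  have hSi : ∀ c : ℝ, Integrable (S.indicator (fun _ => c)) := by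
    intro c
    rw [integrable_indicator_iff hSm]
    exact integrableOn_const (isCompact_closedBall _ _).measure_lt_top.ne
  have hSv : ∀ c : ℝ, ∫ x, S.indicator (fun _ => P * c) x = 2 * c := by
    intro c
    rw [integral_indicator hSm, setIntegral_const, Measure.real, hS, Real.volume_closedBall,
      ENNReal.toReal_ofReal (by positivity), smul_eq_mul]
    field_simp
  have h1 : Integrable (fun x => innI d ξ t A B (x - ξ * t) - innI d 0 t A B x) :=
    ((innI_int d ξ t A B).comp_sub_right (ξ * t)).sub (innI_int _ _ _ _ _)
  have e1 : (∫ x, innI d ξ t A B x) - (∫ x, innI d 0 t A B x) - 2 * ξ * χ =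
      ∫ x, (innI d ξ t A B (x - ξ * t) - innI d 0 t A B x
        - S.indicator (fun _ => P * (ξ * χ)) x) := by
    rw [integral_sub h1 (hSi _), hSv, diff_int]; ring
  rw [e1, ← hSv E, ← Real.norm_eq_abs]
  refine norm_integral_le_of_norm_le (hSi _) (Eventually.of_forall fun x => ?_)
  rw [shift_eq, zero_eq, Real.norm_eq_abs]
  classical
  simp only [Set.indicator_apply, hmem, Set.mem_ofPred_eq]
  by_cases hA : |A + x * t ^ (d + 1)| ≤ 1
  · simpa only [hA, and_true, if_true] using hp x hA
  · simp [hA]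

lemma S_facts (d : ℕ) (t A B x : ℝ) (ht : 1 ≤ |t|) (hA : |A| ≤ d * |t| ^ d)
    (hB : |B| * |t| ≤ d * (d * |t| ^ d)) (hx : |A + x * t ^ (d + 1)| ≤ 1) :
    |x| * |t| ≤ d + 1 ∧ |B + ((d : ℝ) + 1) * x * t ^ d| * |t| ≤
      ((d : ℝ) ^ 2 + (d + 1) ^ 2) * |t| ^ d := by
  have hP : 1 ≤ |t| ^ d := one_le_pow₀ ht
  have h1 : |x| * |t| ≤ d + 1 := by
    have h2 : |x * t ^ (d + 1)| ≤ 1 + |A| := by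
      have := abs_sub (A + x * t ^ (d + 1)) A
      rw [add_sub_cancel_left] at this
      linarith
    rw [abs_mul, abs_pow, pow_succ] at h2
    by_contra! h
    nlinarith
  refine ⟨h1, ?_⟩
  calc |B + ((d : ℝ) + 1) * x * t ^ d| * |t| ≤ (|B| + |((d : ℝ) + 1) * x * t ^ d|) * |t| := by
        gcongr; exact abs_add_le _ _
    _ = |B| * |t| + (d + 1) * (|x| * |t|) * |t| ^ d := by
        rw [abs_mul, abs_mul, abs_pow, abs_of_nonneg (by positivity : (0:ℝ) ≤ d + 1)]; ring
    _ ≤ d * (d * |t| ^ d) + (d + 1) * (d + 1) * |t| ^ d := by gcongr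
    _ = _ := by ring

lemma mid_t (d : ℕ) (ξ t A B : ℝ) (ht : 2 * ((d : ℝ) + 1) ≤ |t|) (hA : |A| ≤ d * |t| ^ d)
    (hB : |B| * |t| ≤ d * (d * |t| ^ d)) (h0 : 0 < ξ) (h4 : ξ ≤ 1 / 4) (h : ξ * t ^ 2 ≤ 1) :
    |(∫ x, innI d ξ t A B x) - (∫ x, innI d 0 t A B x) - 2 * ξ * 1| ≤ 2 * (2 * ξ) := by
  have hd : (0 : ℝ) ≤ d := by positivity
  have ht1 : 1 ≤ |t| := by linarith
  apply big_t _ _ _ _ _ _ _ ht1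
  intro x hx
  obtain ⟨f1, -⟩ := S_facts d t A B x ht1 hA hB hx
  have hx2 : |x| ≤ 1 / 2 := by
    by_contra! hc
    nlinarith
  have hs : |ξ * t| ≤ 1 / 2 := by
    apply abs_le_of_sq_le_sq _ (by norm_num)
    nlinarith
  have hxs : |x - ξ * t| ≤ 1 := by
    have := abs_sub x (ξ * t)
    linarith
  rw [if_pos hxs, if_pos (by linarith)]
  have k1 := abs_abs_sub_abs_le (ξ * t ^ (d + 1) + (B + ((d : ℝ) + 1) * x * t ^ d))
    (B + ((d : ℝ) + 1) * x * t ^ d)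
  rw [add_sub_cancel_right, abs_mul, abs_pow, abs_of_pos h0] at k1
  have hP : 0 ≤ |t| ^ (d + 1) * ξ := by positivity
  rw [abs_le] at k1 ⊢
  constructor <;> linarith [k1.1, k1.2]

lemma large_t (d : ℕ) (ξ t A B χ₂ : ℝ) (ht : 2 * ((d : ℝ) + 1) ≤ |t|) (hA : |A| ≤ d * |t| ^ d)
    (hB : |B| * |t| ≤ d * (d * |t| ^ d)) (h0 : 0 < ξ) 
    (hc0 : 0 ≤ χ₂) (hc : |(|t| - 1 / ξ)| ≤ 2 * ((d : ℝ) + 1) → 1 ≤ χ₂) :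
    |(∫ x, innI d ξ t A B x) - (∫ x, innI d 0 t A B x) - 2 * ξ * (if |t| ≤ 1 / ξ then 1 else 0)|
      ≤ 2 * (2 * ((d : ℝ) ^ 2 + (d + 1) ^ 2) / t ^ 2 + ξ * χ₂) := by
  have hd : (0 : ℝ) ≤ d := by positivity
  have ht1 : 1 ≤ |t| := by linarith
  have htp : 0 < |t| := by linarith
  apply big_t _ _ _ _ _ _ _ ht1
  intro x hx
  obtain ⟨f1, f2⟩ := S_facts d t A B x ht1 hA hB hx
  set K := (d : ℝ) ^ 2 + (d + 1) ^ 2 with hK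
  set ρ := B + ((d : ℝ) + 1) * x * t ^ d with hρ
  set P := |t| ^ (d + 1) with hP
  have hP0 : 0 < P := by positivity
  have hx2 : |x| ≤ 1 / 2 := by
    by_contra! hc
    nlinarith
  have hρ2 : |ρ| ≤ P * (K / t ^ 2) := by
    rw [← sq_abs t, hP, pow_succ]
    have : |t| ^ d * |t| * (K / |t| ^ 2) = K * |t| ^ d / |t| := by field_simp
    rw [this, le_div_iff₀ htp]; exact f2
  have e2 : P * (2 * K / t ^ 2 + ξ * χ₂) = 2 * (P * (K / t ^ 2)) + P * (ξ * χ₂) := by ring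
  rw [e2]
  have hPχ : 0 ≤ P * (ξ * χ₂) := by positivity
  have hPξ : 0 ≤ P * ξ := by positivity
  have k1 := abs_abs_sub_abs_le (ξ * t ^ (d + 1) + ρ) (ξ * t ^ (d + 1))
  have habs : |ξ * t ^ (d + 1)| = P * ξ := by rw [abs_mul, abs_pow, abs_of_pos h0, hP, mul_comm]
  rw [add_sub_cancel_left, habs] at k1
  have hρ0 := abs_nonneg ρ
  rw [if_pos (by linarith : |x| ≤ 1)]
  -- disagreement of the two indicators
  have hdis : (ξ * |t| - |x| ≤ 1) → (1 ≤ ξ * |t| + |x|) → P * ξ ≤ P * (ξ * χ₂) := by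
    intro a b
    have hχ : 1 ≤ χ₂ := by
      apply hc
      have hh : 1 / 2 ≤ ξ * |t| := by linarith
      have e3 : |t| - 1 / ξ = (ξ * |t| - 1) / ξ := by field_simp
      rw [e3, abs_div, abs_of_pos h0, div_le_iff₀ h0]
      have : |ξ * |t| - 1| ≤ |x| := abs_le.2 ⟨by linarith, by linarith⟩
      refine this.trans ?_
      have hx0 := abs_nonneg x
      calc |x| ≤ |x| * (2 * (ξ * |t|)) := by nlinarith
        _ = 2 * ξ * (|x| * |t|) := by ring
        _ ≤ 2 * ξ * (d + 1) := by gcongr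
        _ = _ := by ring
    have : P * ξ * 1 ≤ P * ξ * χ₂ := by gcongr
    linarith
  have hst : |ξ * t| = ξ * |t| := by rw [abs_mul, abs_of_pos h0]
  have t1 : ξ * |t| - |x| ≤ |x - ξ * t| := by
    rw [← hst, abs_sub_comm]; exact abs_sub_abs_le_abs_sub _ _
  have t2 : |x - ξ * t| ≤ ξ * |t| + |x| := by
    rw [← hst, add_comm]; exact abs_sub _ _
  have hiff : |t| ≤ 1 / ξ ↔ ξ * |t| ≤ 1 := by rw [le_div_iff₀ h0, mul_comm]
  rw [abs_le] at k1
  by_cases a : |x - ξ * t| ≤ 1 <;> by_cases b : |t| ≤ 1 / ξ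
  · rw [if_pos a, if_pos b, abs_le]
    constructor <;> linarith [k1.1, k1.2]
  · rw [if_pos a, if_neg b, abs_le]
    rw [hiff] at b
    have := hdis (by linarith) (by linarith [abs_nonneg x])
    constructor <;> linarith [k1.1, k1.2]
  · rw [if_neg a, if_pos b, abs_le]
    rw [hiff] at b
    have := hdis (by linarith [abs_nonneg x]) (by linarith)
    constructor <;> linarith [k1.1, k1.2]
  · rw [if_neg a, if_neg b, abs_le]
    constructor <;> linarith [k1.1, k1.2]

noncomputable def chi2 (c ξ t : ℝ) : ℝ :=
  (Set.Icc (1 / ξ - c) (1 / ξ + c)).indicator (fun _ => (1 : ℝ)) t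
    + (Set.Icc (-(1 / ξ) - c) (-(1 / ξ) + c)).indicator (fun _ => (1 : ℝ)) t

lemma chi2_nonneg (c ξ t : ℝ) : 0 ≤ chi2 c ξ t :=
  add_nonneg (Set.indicator_nonneg (fun _ _ => zero_le_one) _)
    (Set.indicator_nonneg (fun _ _ => zero_le_one) _)

lemma chi2_one (c ξ t : ℝ) (h : |(|t| - 1 / ξ)| ≤ c) : 1 ≤ chi2 c ξ t := by
  rw [abs_le] at h
  have n1 : 0 ≤ (Set.Icc (1 / ξ - c) (1 / ξ + c)).indicator (fun _ => (1 : ℝ)) t :=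
    Set.indicator_nonneg (fun _ _ => zero_le_one) _
  have n2 : 0 ≤ (Set.Icc (-(1 / ξ) - c) (-(1 / ξ) + c)).indicator (fun _ => (1 : ℝ)) t :=
    Set.indicator_nonneg (fun _ _ => zero_le_one) _
  rw [chi2]
  rcases abs_cases t with ⟨a, -⟩ | ⟨a, -⟩ <;> rw [a] at h
  · rw [Set.indicator_of_mem (Set.mem_Icc.2 ⟨by linarith, by linarith⟩)]; linarith
  · rw [add_comm, Set.indicator_of_mem (Set.mem_Icc.2 ⟨by linarith, by linarith⟩)]; linarith

lemma ind_int (a b c : ℝ) : Integrable ((Set.Icc a b).indicator (fun _ => c)) := by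
  rw [integrable_indicator_iff measurableSet_Icc]
  exact integrableOn_const (by simp)

lemma ind_val (a b c : ℝ) (h : a ≤ b) :
    ∫ x, (Set.Icc a b).indicator (fun _ => c) x = (b - a) * c := by
  rw [integral_indicator measurableSet_Icc, setIntegral_const]
  simp [h]

lemma chi2_int (c ξ : ℝ) (hc : 0 ≤ c) :
    Integrable (chi2 c ξ) ∧ ∫ t, chi2 c ξ t = 4 * c := by
  refine ⟨(ind_int _ _ _).add (ind_int _ _ _), ?_⟩
  simp only [chi2]
  rw [integral_add (ind_int _ _ _) (ind_int _ _ _), ind_val _ _ _ (by linarith),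
    ind_val _ _ _ (by linarith)]
  ring

lemma cauchy_int (ξ : ℝ) (h0 : 0 < ξ) :
    Integrable (fun t : ℝ => ξ / (1 + ξ * t ^ 2)) ∧
    ∫ t : ℝ, ξ / (1 + ξ * t ^ 2) = Real.pi * √ξ := by
  have hs : 0 < √ξ := Real.sqrt_pos.2 h0
  have e : (fun t : ℝ => ξ / (1 + ξ * t ^ 2)) = fun t => ξ * (1 + (√ξ * t) ^ 2)⁻¹ := by
    funext t
    rw [mul_pow, Real.sq_sqrt h0.le]; rfl
  rw [e]
  constructor
  · exact ((integrable_inv_one_add_sq).comp_mul_left' hs.ne').const_mul ξ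
  · rw [integral_const_mul, Measure.integral_comp_mul_left (fun x : ℝ => (1 + x ^ 2)⁻¹),
      integral_univ_inv_one_add_sq, abs_of_pos (by positivity), smul_eq_mul]
    nth_rewrite 1 [← Real.sq_sqrt h0.le]
    field_simp

/-- combined bound on the inner integral -/
lemma inner_bd (d : ℕ) : ∃ C : ℝ, 0 < C ∧ ∃ ξ₀ : ℝ, 0 < ξ₀ ∧ ξ₀ ≤ 1 ∧ ∀ ξ, 0 < ξ → ξ < ξ₀ → ∀ t,
    ∀ q ∈ cubeS d, |(∫ x, innI d ξ t (Af d t q) (Bf d t q) x)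
      - (∫ x, innI d 0 t (Af d t q) (Bf d t q) x) - 2 * ξ * (if |t| ≤ 1 / ξ then 1 else 0)|
      ≤ C * (ξ / (1 + ξ * t ^ 2)) + 2 * ξ * chi2 (2 * ((d : ℝ) + 1)) ξ t := by
  set M : ℝ := 2 * ((d : ℝ) + 1) with hM
  have hd : (0 : ℝ) ≤ d := by positivity
  have hM2 : 2 ≤ M := by linarith
  set Cs := 2 * M ^ (d + 1) + 4 * M * (M ^ (d + 1) + d * (d * M ^ d) + 2 * (d + 1) * M ^ d) with hCs
  have hCs0 : 0 ≤ Cs := by positivity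
  set K := (d : ℝ) ^ 2 + (d + 1) ^ 2 with hK
  have hK0 : 0 ≤ K := by positivity
  refine ⟨2 * (Cs + 4 + 4 * K), by positivity, 1 / (M ^ 2), by positivity, ?_, ?_⟩
  · rw [div_le_one (by positivity)]; nlinarith
  intro ξ h0 hξ t q hq
  rw [lt_div_iff₀ (by positivity)] at hξ
  have h4 : ξ ≤ 1 / 4 := by nlinarith
  have hξM : ξ * M ≤ 1 := by nlinarith
  have hchi := chi2_nonneg M ξ t
  have hchi' : 0 ≤ 2 * ξ * chi2 M ξ t := by positivity
  have hden : 0 < 1 + ξ * t ^ 2 := by positivity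
  set u := ξ / (1 + ξ * t ^ 2) with hu
  have hu0 : 0 ≤ u := by positivity
  have hsm : ξ * t ^ 2 ≤ 1 → ξ ≤ 2 * u := by
    intro h
    rw [hu, ← mul_div_assoc, le_div_iff₀ hden]; nlinarith
  have hif : ξ * t ^ 2 ≤ 1 → |t| ≤ 1 / ξ := by
    intro h
    rw [le_div_iff₀ h0]
    have : |t| * ξ = |t * ξ| := by rw [abs_mul, abs_of_pos h0]
    rw [this]
    apply abs_le_of_sq_le_sq _ (by norm_num)
    nlinarith
  by_cases hc1 : |t| ≤ M
  · have := small_t d ξ t (Af d t q) (Bf d t q) M _ (by linarith) hc1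
      (Bf_bd2 d t M (by linarith) hc1 q hq) h0 hξM
    rw [← hCs] at this
    have ht2 : ξ * t ^ 2 ≤ 1 := by
      have : t ^ 2 ≤ M ^ 2 := by rw [← sq_abs]; gcongr
      nlinarith
    rw [if_pos (hif ht2)]
    have h5 := hsm ht2
    have h6 : Cs * ξ ≤ Cs * (2 * u) := by gcongr
    have h7 : 0 ≤ K * u := by positivity
    rw [abs_le] at this ⊢
    constructor <;> nlinarith [this.1, this.2]
  · push Not at hc1
    have ht1 : 1 ≤ |t| := by linarith
    have hA := Af_bd d t ht1 q hq
    have hB := Bf_bd d t ht1 q hq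
    by_cases hc2 : ξ * t ^ 2 ≤ 1
    · rw [if_pos (hif hc2)]
      have := mid_t d ξ t _ _ hc1.le hA hB h0 h4 hc2
      have h5 := hsm hc2
      have h7 : 0 ≤ K * u := by positivity
      have h8 : 0 ≤ Cs * u := by positivity
      refine this.trans ?_
      linarith
    · have := large_t d ξ t _ _ (chi2 M ξ t) hc1.le hA hB h0 hchi (chi2_one M ξ t)
      refine this.trans ?_
      push Not at hc2
      have ht0 : 0 < t ^ 2 := by rw [← sq_abs]; positivity
      have h9 : 1 / t ^ 2 ≤ 2 * u := by
        rw [hu, ← mul_div_assoc, div_le_div_iff₀ ht0 hden]; linarith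
      have h10 : K * (1 / t ^ 2) ≤ K * (2 * u) := by gcongr
      have h8 : 0 ≤ Cs * u := by positivity
      have : 2 * (2 * K / t ^ 2 + ξ * chi2 M ξ t) = 4 * (K * (1 / t ^ 2)) + 2 * ξ * chi2 M ξ t := by
        ring
      rw [← hK, this]
      linarith

lemma main_aux (d : ℕ) :
    ∃ C : ℝ, 0 < C ∧ ∃ ξ₀ : ℝ, 0 < ξ₀ ∧ ∀ ξ : ℝ, 0 < ξ → ξ < ξ₀ →
      |(∫ t : ℝ, (omegaFn (d + 2) ξ t - phiFn (d + 1) t)) - 2 ^ (d + 2)| ≤ C * Real.sqrt ξ := by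
  obtain ⟨C, hC, ξ₀, hξ₀, hξ1, H⟩ := inner_bd d
  set M : ℝ := 2 * ((d : ℝ) + 1) with hM
  have hM0 : 0 < M := by positivity
  refine ⟨2 ^ d * (C * Real.pi + 8 * M), by positivity, ξ₀, hξ₀, ?_⟩
  intro ξ h0 hξ
  set h : ℝ → ℝ := (Set.Icc (-(1 / ξ)) (1 / ξ)).indicator (fun _ => 2 ^ d * (2 * ξ)) with hh
  set e : ℝ → ℝ := fun t => 2 ^ d * (C * (ξ / (1 + ξ * t ^ 2)) + 2 * ξ * chi2 M ξ t) with he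
  have hhe : ∀ t, h t = 2 ^ d * (2 * ξ * (if |t| ≤ 1 / ξ then 1 else 0)) := by
    intro t
    classical
    simp only [hh, Set.indicator_apply, Set.mem_Icc, ← abs_le]
    split_ifs <;> ring
  have key : ∀ t, ‖omegaFn (d + 2) ξ t - phiFn (d + 1) t - h t‖ ≤ e t := by
    intro t
    rw [phi_eq]
    obtain ⟨i1, e1⟩ := omega_fubini d ξ t
    obtain ⟨i2, e2⟩ := omega_fubini d 0 t
    have hfin : volume (cubeS d) < ⊤ := by
      rw [cubeS_eq]; exact isCompact_Icc.measure_lt_top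
    have i3 : IntegrableOn (fun _ : Fin d → ℝ => 2 * ξ * (if |t| ≤ 1 / ξ then (1 : ℝ) else 0))
      (cubeS d) := integrableOn_const hfin.ne
    have e3 : h t = ∫ q in cubeS d, 2 * ξ * (if |t| ≤ 1 / ξ then (1 : ℝ) else 0) := by
      rw [setIntegral_const, cubeS_vol, hhe, smul_eq_mul]
    have i4 : IntegrableOn (fun q => (∫ x, innI d ξ t (Af d t q) (Bf d t q) x)
      - (∫ x, innI d 0 t (Af d t q) (Bf d t q) x)) (cubeS d) := i1.sub i2
    rw [e1, e2, e3, ← integral_sub i1 i2, ← integral_sub i4 i3]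
    have := norm_setIntegral_le_of_norm_le_const (C := C * (ξ / (1 + ξ * t ^ 2)) + 2 * ξ * chi2 M ξ t)
      hfin (f := fun q => (∫ x, innI d ξ t (Af d t q) (Bf d t q) x)
      - (∫ x, innI d 0 t (Af d t q) (Bf d t q) x) - 2 * ξ * (if |t| ≤ 1 / ξ then (1 : ℝ) else 0))
      (fun q hq => H ξ h0 hξ t q hq)
    rw [cubeS_vol] at this
    exact this.trans (le_of_eq (mul_comm _ _))
  obtain ⟨ci, cv⟩ := cauchy_int ξ h0
  obtain ⟨xi, xv⟩ := chi2_int M ξ hM0.le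
  have hei : Integrable e := ((ci.const_mul C).add (xi.const_mul (2 * ξ))).const_mul _
  have hev : ∫ t, e t = 2 ^ d * (C * (Real.pi * √ξ) + 2 * ξ * (4 * M)) := by
    simp only [he]
    rw [integral_const_mul, integral_add (ci.const_mul C) (xi.const_mul (2 * ξ)),
      integral_const_mul, integral_const_mul, cv, xv]
  have hhi : Integrable h := ind_int _ _ _
  have hhv : ∫ t, h t = 2 ^ (d + 2) := by
    have : 0 < 1 / ξ := by positivity
    rw [hh, ind_val _ _ _ (by linarith)]
    field_simp; ring
  have hmeas : AEStronglyMeasurable (fun t => omegaFn (d + 2) ξ t - phiFn (d + 1) t) volume := by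
    simp only [phi_eq]
    exact ((omega_meas _ _).sub (omega_meas _ _)).aestronglyMeasurable
  have hdi : Integrable (fun t => omegaFn (d + 2) ξ t - phiFn (d + 1) t - h t) :=
    Integrable.mono' hei (hmeas.sub hhi.aestronglyMeasurable) (Eventually.of_forall key)
  have hwi : Integrable (fun t => omegaFn (d + 2) ξ t - phiFn (d + 1) t) := by
    have := hdi.add hhi
    refine this.congr (Eventually.of_forall fun t => ?_)
    simp
  rw [← hhv, ← integral_sub hwi hhi, ← Real.norm_eq_abs]
  refine (norm_integral_le_of_norm_le hei (Eventually.of_forall key)).trans ?_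
  rw [hev, mul_assoc ((2 : ℝ) ^ d) (C * Real.pi + 8 * M)]
  have hs : ξ ≤ √ξ := by
    apply Real.le_sqrt_of_sq_le; nlinarith
  have : ξ * M ≤ √ξ * M := by gcongr
  gcongr
  linarith

theorem integral_omega_sub_phi (n : ℕ) (hn : 2 ≤ n) :
    ∃ C : ℝ, 0 < C ∧ ∃ ξ₀ : ℝ, 0 < ξ₀ ∧ ∀ ξ : ℝ, 0 < ξ → ξ < ξ₀ →
      |(∫ t : ℝ, (omegaFn n ξ t - phiFn (n - 1) t)) - 2 ^ n| ≤ C * Real.sqrt ξ := by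
  obtain ⟨d, rfl⟩ := Nat.exists_eq_add_of_le' hn
  exact main_aux d
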